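/- There exists a constant M₁ > 0 such that for every M ∈ (0, M₁), every ω ∈ S_M, and all constants W > 0 and γ ≥ 0 with ω = 1_{{x ∈ ℝ²₊ : 𝒢[ω](x) − W·x₂ − γ > 0}} a.e. in ℝ²₊, one has γ = 0 (the flux constant of every maximizer with sufficiently small impulse vanishes). -/

import Mathlib

open MeasureTheory Real Set NNReal Filter Topology

noncomputable section

/-- The upper half plane `ℝ²₊`. -/
def H : Set (ℝ × ℝ) := {p | 0 < p.2}

/-- The half-plane Green function
`G(x,y) = (1/(4π)) log(1 + 4 x₂ y₂ / |x-y|²)` (Euclidean distance). -/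
def G (x y : ℝ × ℝ) : ℝ :=
  (1 / (4 * π)) * Real.log (1 + 4 * x.2 * y.2 / ((x.1 - y.1) ^ 2 + (x.2 - y.2) ^ 2))

/-- The potential `𝒢[ω](x) = ∫_{ℝ²₊} G(x,y) ω(y) dy`. -/
def Gpot (ω : ℝ × ℝ → ℝ) (x : ℝ × ℝ) : ℝ := ∫ y in H, G x y * ω y

/-- The kinetic energy `E(ω) = (1/2) ∫∫ G(x,y) ω(x) ω(y) dy dx`. -/
def energy (ω : ℝ × ℝ → ℝ) : ℝ :=
  (1 / 2) * ∫ x in H, ∫ y in H, G x y * ω x * ω y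

/-- The `L¹(ℝ²₊)` norm (mass). -/
def norm1 (ω : ℝ × ℝ → ℝ) : ℝ := ∫ x in H, |ω x|

/-- The `L²(ℝ²₊)` norm. -/
def norm2 (ω : ℝ × ℝ → ℝ) : ℝ := (∫ x in H, ω x ^ 2) ^ ((1 : ℝ) / 2)

/-- The impulse `‖x₂ ω‖₁ = ∫_{ℝ²₊} x₂ |ω(x)| dx`. -/
def impulse (ω : ℝ × ℝ → ℝ) : ℝ := ∫ x in H, x.2 * |ω x|

/-- `ω ∈ (L¹ ∩ L²)(ℝ²₊)`. -/
def MemL1L2 (ω : ℝ × ℝ → ℝ) : Prop :=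
  Integrable ω (volume.restrict H) ∧ Integrable (fun x => ω x ^ 2) (volume.restrict H)

/-- Finiteness of the impulse `‖x₂ ω‖₁ < ∞`. -/
def ImpulseFinite (ω : ℝ × ℝ → ℝ) : Prop :=
  Integrable (fun x : ℝ × ℝ => x.2 * |ω x|) (volume.restrict H)

/-- The admissible class `K_M`: patches `ω = 1_A` a.e. on `ℝ²₊` with
impulse `∫_A x₂ = M` and mass `|A| ≤ 1`. -/
def memK (M : ℝ) (ω : ℝ × ℝ → ℝ) : Prop :=
  Integrable ω (volume.restrict H) ∧
  ∃ A : Set (ℝ × ℝ), A ⊆ H ∧ MeasurableSet A ∧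
    (∀ᵐ x ∂volume.restrict H, ω x = A.indicator (fun _ => (1 : ℝ)) x) ∧
    (∫ x in A, x.2) = M ∧ volume A ≤ 1

/-- The admissible class `K_{M,∞}`: patches `ω = 1_A` a.e. on `ℝ²₊` with
impulse `∫_A x₂ = M`, without any mass bound. -/
def memKinf (M : ℝ) (ω : ℝ × ℝ → ℝ) : Prop :=
  Integrable ω (volume.restrict H) ∧
  ∃ A : Set (ℝ × ℝ), A ⊆ H ∧ MeasurableSet A ∧
    (∀ᵐ x ∂volume.restrict H, ω x = A.indicator (fun _ => (1 : ℝ)) x) ∧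
    (∫ x in A, x.2) = M

/-- The relaxed admissible class `K̃_M`: measurable `0 ≤ ω ≤ 1` with
mass `≤ 1` and impulse `≤ M`. -/
def memKt (M : ℝ) (ω : ℝ × ℝ → ℝ) : Prop :=
  Integrable ω (volume.restrict H) ∧
  (∀ᵐ x ∂volume.restrict H, 0 ≤ ω x ∧ ω x ≤ 1) ∧
  norm1 ω ≤ 1 ∧
  Integrable (fun x : ℝ × ℝ => x.2 * |ω x|) (volume.restrict H) ∧
  impulse ω ≤ M

/-- The set of maximizers `S_M` of the energy over `K_M`. -/
def memS (M : ℝ) (ω : ℝ × ℝ → ℝ) : Prop :=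
  memK M ω ∧ ∀ ω' : ℝ × ℝ → ℝ, memK M ω' → energy ω' ≤ energy ω

/-- The maximal energy `I_M` over `K_M`. -/
def Isup (M : ℝ) : ℝ := sSup (energy '' {ω | memK M ω})

/-- The maximal energy `I_{1,∞}` over `K_{1,∞}`. -/
def IsupInf : ℝ := sSup (energy '' {ω | memKinf 1 ω})

/-- The Steiner symmetry condition for a set `Ω ⊆ ℝ²₊`. -/
def SteinerSet (Ω : Set (ℝ × ℝ)) : Prop :=
  (∀ x₁ x₂ : ℝ, 0 < x₂ → (((x₁, x₂) : ℝ × ℝ) ∈ Ω ↔ ((-x₁, x₂) : ℝ × ℝ) ∈ Ω)) ∧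
  (∀ x₂ : ℝ, 0 < x₂ → ∀ a b : ℝ, 0 ≤ a → a ≤ b →
    ((b, x₂) : ℝ × ℝ) ∈ Ω → ((a, x₂) : ℝ × ℝ) ∈ Ω)

/-- The Steiner symmetry condition for a nonnegative function on `ℝ²₊`. -/
def SteinerFn (f : ℝ × ℝ → ℝ) : Prop :=
  (∀ x₁ x₂ : ℝ, 0 < x₂ → f (x₁, x₂) = f (-x₁, x₂)) ∧
  (∀ x₂ : ℝ, 0 < x₂ → ∀ a b : ℝ, 0 ≤ a → a ≤ b → f (b, x₂) ≤ f (a, x₂))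


/-! ### Pointwise bounds on the Green function -/

lemma dist_sq_le (x y : ℝ × ℝ) : dist x y ^ 2 ≤ (x.1 - y.1) ^ 2 + (x.2 - y.2) ^ 2 := by
  rw [Prod.dist_eq, Real.dist_eq, Real.dist_eq]
  rcases max_cases |x.1 - y.1| |x.2 - y.2| with h | h <;> rw [h.1, sq_abs] <;>
    nlinarith [sq_nonneg (x.1 - y.1), sq_nonneg (x.2 - y.2)]

lemma abs_fst_sub_le_dist (x y : ℝ × ℝ) : |x.1 - y.1| ≤ dist x y := by
  rw [Prod.dist_eq, Real.dist_eq]; exact le_max_left _ _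

lemma abs_snd_sub_le_dist (x y : ℝ × ℝ) : |x.2 - y.2| ≤ dist x y := by
  rw [Prod.dist_eq, Real.dist_eq, Real.dist_eq]; exact le_max_right _ _

lemma G_symm (x y : ℝ × ℝ) : G x y = G y x := by
  unfold G
  rw [show (x.1 - y.1) ^ 2 + (x.2 - y.2) ^ 2 = (y.1 - x.1) ^ 2 + (y.2 - x.2) ^ 2 by ring,
    show 4 * x.2 * y.2 = 4 * y.2 * x.2 by ring]

lemma G_nonneg {x y : ℝ × ℝ} (hx : x ∈ H) (hy : y ∈ H) : 0 ≤ G x y := by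
  have hx' : 0 < x.2 := hx
  have hy' : 0 < y.2 := hy
  unfold G
  refine mul_nonneg (by positivity) (Real.log_nonneg ?_)
  have : 0 ≤ 4 * x.2 * y.2 / ((x.1 - y.1) ^ 2 + (x.2 - y.2) ^ 2) := by positivity
  linarith

lemma G_self (x : ℝ × ℝ) : G x x = 0 := by simp [G]

lemma measurable_G : Measurable (Function.uncurry G) := by
  unfold G Function.uncurry
  fun_prop

lemma measurable_G_right (x : ℝ × ℝ) : Measurable (G x) :=
  measurable_G.comp measurable_prodMk_left

lemma G_le_log {x y : ℝ × ℝ} (hx : x ∈ H) (hy : y ∈ H) (hxy : x ≠ y) :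
    G x y ≤ (1 / (4 * π)) * Real.log (1 + 4 * x.2 * y.2 / dist x y ^ 2) := by
  have hx' : 0 < x.2 := hx
  have hy' : 0 < y.2 := hy
  have hd : 0 < dist x y := dist_pos.2 hxy
  unfold G
  have h := dist_sq_le x y
  gcongr

lemma G_le_inv_dist {x y : ℝ × ℝ} (hx : x ∈ H) (hy : y ∈ H) :
    G x y ≤ x.2 / π * (dist x y)⁻¹ := by
  rcases eq_or_ne x y with rfl | hxy
  · simp [G_self]
  have hx' : 0 < x.2 := hx
  have hy' : 0 < y.2 := hy
  have hd : 0 < dist x y := dist_pos.2 hxy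
  have hpi := Real.pi_pos
  have hyx : y.2 ≤ x.2 + dist x y := by
    have := (abs_le.1 (abs_snd_sub_le_dist x y)).1; linarith
  have h1 : 1 + 4 * x.2 * y.2 / dist x y ^ 2 ≤ (1 + 2 * x.2 / dist x y) ^ 2 := by
    calc _ ≤ 1 + 4 * x.2 * (x.2 + dist x y) / dist x y ^ 2 := by gcongr
      _ = _ := by field_simp; ring
  have h2 : Real.log (1 + 4 * x.2 * y.2 / dist x y ^ 2) ≤ 2 * (2 * x.2 / dist x y) := by
    calc _ ≤ Real.log ((1 + 2 * x.2 / dist x y) ^ 2) := Real.log_le_log (by positivity) h1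
      _ = 2 * Real.log (1 + 2 * x.2 / dist x y) := by rw [Real.log_pow]; norm_num
      _ ≤ _ := by
        have := Real.log_le_sub_one_of_pos (show 0 < 1 + 2 * x.2 / dist x y by positivity)
        linarith
  calc G x y ≤ _ := G_le_log hx hy hxy
    _ ≤ (1 / (4 * π)) * (2 * (2 * x.2 / dist x y)) := by gcongr
    _ = _ := by field_simp; ring

lemma G_le_inv_dist_sq {x y : ℝ × ℝ} (hx : x ∈ H) (hy : y ∈ H) :
    G x y ≤ x.2 / π * (y.2 / dist x y ^ 2) := by
  rcases eq_or_ne x y with rfl | hxy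
  · simp [G_self]
  have hx' : 0 < x.2 := hx
  have hy' : 0 < y.2 := hy
  have hd : 0 < dist x y := dist_pos.2 hxy
  have hpi := Real.pi_pos
  calc G x y ≤ _ := G_le_log hx hy hxy
    _ ≤ (1 / (4 * π)) * (4 * x.2 * y.2 / dist x y ^ 2) := by
      gcongr
      have := Real.log_le_sub_one_of_pos (show 0 < 1 + 4 * x.2 * y.2 / dist x y ^ 2 by positivity)
      linarith
    _ = _ := by field_simp

/-! ### Integrals of the kernel `1 / |x - y|` -/

lemma integrableOn_inv_dist_ball (x : ℝ × ℝ) (r : ℝ) :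
    IntegrableOn (fun y => (dist x y)⁻¹) (Metric.ball x r) := by
  have h : IntegrableOn (fun z : ℝ × ℝ => ‖z‖⁻¹) (Metric.ball 0 r) := by
    rw [integrableOn_fun_norm_addHaar volume (f := fun t => t⁻¹)]
    have : IntegrableOn (fun _ : ℝ => (1 : ℝ)) (Ioo 0 r) := by simp
    refine this.congr_fun (fun t ht => ?_) measurableSet_Ioo
    have : t ≠ 0 := ht.1.ne'
    simp [this]
  have h2 := (integrable_indicator_iff Metric.isOpen_ball.measurableSet).2 h
  have h3 := h2.comp_sub_left x
  rw [← integrable_indicator_iff Metric.isOpen_ball.measurableSet]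
  have h4 : (Metric.ball x r).indicator (fun y => (dist x y)⁻¹) =
      fun y => (Metric.ball 0 r).indicator (fun z : ℝ × ℝ => ‖z‖⁻¹) (x - y) := by
    ext y
    simp only [indicator, Metric.mem_ball, dist_eq_norm, sub_zero, norm_sub_rev y x]
  rw [h4]
  exact h3

lemma integral_inv_dist_ball (x : ℝ × ℝ) {r : ℝ} (hr : 0 ≤ r) :
    ∫ y in Metric.ball x r, (dist x y)⁻¹ = 8 * r := by
  have h := integral_fun_norm_addHaar (volume : Measure (ℝ × ℝ)) ((Iio r).indicator fun t => t⁻¹)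
  have hv : (volume : Measure (ℝ × ℝ)).real (Metric.ball 0 1) = 4 := by
    rw [show (0 : ℝ × ℝ) = (0, 0) from rfl, ← ball_prod_same, Measure.volume_eq_prod,
      measureReal_prod_prod]
    simp [Measure.real, Real.volume_ball]; norm_num
  have hI : ∫ y in Ioi (0 : ℝ), y ^ (Module.finrank ℝ (ℝ × ℝ) - 1) •
      (Iio r).indicator (fun t => t⁻¹) y = r := by
    have : ∫ y in Ioi (0 : ℝ), y ^ (Module.finrank ℝ (ℝ × ℝ) - 1) •
        (Iio r).indicator (fun t => t⁻¹) y = ∫ y in Ioi (0 : ℝ), (Iio r).indicator 1 y := by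
      refine setIntegral_congr_fun measurableSet_Ioi fun t (ht : 0 < t) => ?_
      by_cases h : t < r <;> simp [h, ht.ne']
    rw [this, setIntegral_indicator measurableSet_Iio, Ioi_inter_Iio]
    simp [hr]
  rw [hv, hI] at h
  rw [← integral_indicator Metric.isOpen_ball.measurableSet]
  have h4 := integral_sub_left_eq_self
    (fun z : ℝ × ℝ => (Iio r).indicator (fun t => t⁻¹) ‖z‖) volume x
  rw [h] at h4
  have h5 : (Metric.ball x r).indicator (fun y => (dist x y)⁻¹) =
      fun y => (Iio r).indicator (fun t => t⁻¹) ‖x - y‖ := by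
    ext y
    simp only [indicator, Metric.mem_ball, dist_eq_norm, norm_sub_rev y x, mem_Iio]
  rw [h5, h4]
  simp; ring

lemma measurable_inv_dist (x : ℝ × ℝ) : Measurable fun y => (dist x y)⁻¹ := by fun_prop

lemma integrableOn_inv_dist {S : Set (ℝ × ℝ)} (hS : MeasurableSet S) (hf : volume S ≠ ⊤)
    (x : ℝ × ℝ) : IntegrableOn (fun y => (dist x y)⁻¹) S := by
  have h : S = S ∩ Metric.ball x 1 ∪ S \ Metric.ball x 1 := (inter_union_sdiff _ _).symm
  rw [h]
  refine ((integrableOn_inv_dist_ball x 1).mono_set inter_subset_right).union ?_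
  refine Measure.integrableOn_of_bounded (M := 1) (measure_ne_top_of_subset sdiff_subset hf)
    (measurable_inv_dist x).aestronglyMeasurable ?_
  refine (ae_restrict_iff' (hS.diff Metric.isOpen_ball.measurableSet)).2 (ae_of_all _ ?_)
  intro y hy
  have : 1 ≤ dist x y := by
    have := hy.2; rw [Metric.mem_ball, not_lt, dist_comm] at this; exact this
  rw [Real.norm_of_nonneg (by positivity)]
  exact inv_le_one_of_one_le₀ this

lemma setIntegral_inv_dist_inter_ball_le (S : Set (ℝ × ℝ)) (x : ℝ × ℝ) {r : ℝ} (hr : 0 ≤ r) :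
    ∫ y in S ∩ Metric.ball x r, (dist x y)⁻¹ ≤ 8 * r := by
  rw [← integral_inv_dist_ball x hr]
  exact setIntegral_mono_set (integrableOn_inv_dist_ball x r)
    (ae_of_all _ fun y => by positivity) inter_subset_right.eventuallyLE

lemma setIntegral_inv_dist_le {S : Set (ℝ × ℝ)} (hS : MeasurableSet S) (hf : volume S ≠ ⊤)
    (x : ℝ × ℝ) : ∫ y in S, (dist x y)⁻¹ ≤ 8 + volume.real S := by
  have hi := integrableOn_inv_dist hS hf x
  rw [← integral_inter_add_sdiff (t := Metric.ball x 1) Metric.isOpen_ball.measurableSet hi]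
  have h1 := setIntegral_inv_dist_inter_ball_le S x zero_le_one
  have h2 : ∫ y in S \ Metric.ball x 1, (dist x y)⁻¹ ≤ ∫ y in S \ Metric.ball x 1, (1 : ℝ) := by
    refine setIntegral_mono_on (hi.mono_set sdiff_subset)
      (integrableOn_const (measure_ne_top_of_subset sdiff_subset hf))
      (hS.diff Metric.isOpen_ball.measurableSet) ?_
    intro y hy
    have : 1 ≤ dist x y := by
      have := hy.2; rw [Metric.mem_ball, not_lt, dist_comm] at this; exact this
    exact inv_le_one_of_one_le₀ this
  have h3 : ∫ y in S \ Metric.ball x 1, (1 : ℝ) ≤ volume.real S := by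
    simp only [integral_const, MeasurableSet.univ, measureReal_restrict_apply, univ_inter,
      smul_eq_mul, mul_one]
    exact measureReal_mono sdiff_subset hf
  linarith

/-! ### Patches, their potentials and their mutual interaction -/

/-- A patch: a measurable subset of the half plane with finite area and finite impulse. -/
structure IsPatch (S : Set (ℝ × ℝ)) : Prop where
  measurableSet : MeasurableSet S
  subset : S ⊆ H
  volume_ne_top : volume S ≠ ⊤
  integrableOn_snd : IntegrableOn (fun x : ℝ × ℝ => x.2) S

/-- The potential of a patch. -/
def pot (S : Set (ℝ × ℝ)) (x : ℝ × ℝ) : ℝ := ∫ y in S, G x y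

lemma IsPatch.mono {S T : Set (ℝ × ℝ)} (hS : IsPatch S) (hT : MeasurableSet T) (h : T ⊆ S) :
    IsPatch T :=
  ⟨hT, h.trans hS.subset, measure_ne_top_of_subset h hS.volume_ne_top,
    hS.integrableOn_snd.mono_set h⟩

lemma IsPatch.union {S T : Set (ℝ × ℝ)} (hS : IsPatch S) (hT : IsPatch T) : IsPatch (S ∪ T) :=
  ⟨hS.measurableSet.union hT.measurableSet, union_subset hS.subset hT.subset,
    (measure_union_lt_top hS.volume_ne_top.lt_top hT.volume_ne_top.lt_top).ne,
    hS.integrableOn_snd.union hT.integrableOn_snd⟩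

lemma IsPatch.integrable_kernel {S T : Set (ℝ × ℝ)} (hS : IsPatch S) (hT : MeasurableSet T)
    (hf : volume T ≠ ⊤) :
    Integrable (fun p : (ℝ × ℝ) × (ℝ × ℝ) => p.1.2 * (dist p.1 p.2)⁻¹)
      ((volume.restrict S).prod (volume.restrict T)) := by
  have hm : Measurable (fun p : (ℝ × ℝ) × (ℝ × ℝ) => p.1.2 * (dist p.1 p.2)⁻¹) := by fun_prop
  rw [integrable_prod_iff hm.aestronglyMeasurable]
  refine ⟨ae_of_all _ fun x => (integrableOn_inv_dist hT hf x).const_mul x.2, ?_⟩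
  refine (hS.integrableOn_snd.mul_const (8 + volume.real T)).mono'
    hm.aestronglyMeasurable.norm.integral_prod_right' ?_
  refine (ae_restrict_iff' hS.measurableSet).2 (ae_of_all _ fun x hx => ?_)
  have hx' : 0 < x.2 := hS.subset hx
  rw [Real.norm_of_nonneg (integral_nonneg fun y => norm_nonneg _)]
  have : ∀ y, ‖x.2 * (dist x y)⁻¹‖ = x.2 * (dist x y)⁻¹ := fun y =>
    Real.norm_of_nonneg (by positivity)
  simp only [this, integral_const_mul]
  gcongr
  exact setIntegral_inv_dist_le hT hf x

lemma IsPatch.integrable_G_prod {S T : Set (ℝ × ℝ)} (hS : IsPatch S) (hT : IsPatch T) :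
    Integrable (Function.uncurry G) ((volume.restrict S).prod (volume.restrict T)) := by
  refine ((hS.integrable_kernel hT.measurableSet hT.volume_ne_top).const_mul (1 / π)).mono'
    measurable_G.aestronglyMeasurable ?_
  rw [Measure.prod_restrict]
  refine (ae_restrict_iff' (hS.measurableSet.prod hT.measurableSet)).2 (ae_of_all _ ?_)
  rintro ⟨x, y⟩ ⟨hx, hy⟩
  have hx := hS.subset hx
  have hy := hT.subset hy
  change ‖G x y‖ ≤ 1 / π * (x.2 * (dist x y)⁻¹)
  rw [Real.norm_of_nonneg (G_nonneg hx hy)]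
  exact (G_le_inv_dist hx hy).trans (le_of_eq (by ring))

lemma IsPatch.integrableOn_G {T : Set (ℝ × ℝ)} (hT : IsPatch T) {x : ℝ × ℝ} (hx : x ∈ H) :
    IntegrableOn (G x) T := by
  refine ((integrableOn_inv_dist hT.measurableSet hT.volume_ne_top x).const_mul (x.2 / π)).mono'
    (measurable_G_right x).aestronglyMeasurable ?_
  refine (ae_restrict_iff' hT.measurableSet).2 (ae_of_all _ fun y hy => ?_)
  rw [Real.norm_of_nonneg (G_nonneg hx (hT.subset hy))]
  exact G_le_inv_dist hx (hT.subset hy)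

lemma IsPatch.integrableOn_pot {S T : Set (ℝ × ℝ)} (hS : IsPatch S) (hT : IsPatch T) :
    IntegrableOn (pot T) S :=
  (hS.integrable_G_prod hT).integral_prod_left

lemma IsPatch.pot_nonneg {T : Set (ℝ × ℝ)} (hT : IsPatch T) {x : ℝ × ℝ} (hx : x ∈ H) :
    0 ≤ pot T x :=
  setIntegral_nonneg hT.measurableSet fun _ hy => G_nonneg hx (hT.subset hy)

lemma IsPatch.pot_le {T : Set (ℝ × ℝ)} (hT : IsPatch T) {x : ℝ × ℝ} (hx : x ∈ H) :
    pot T x ≤ x.2 / π * (8 + volume.real T) := by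
  have hx' : 0 < x.2 := hx
  have hi := integrableOn_inv_dist hT.measurableSet hT.volume_ne_top x
  calc pot T x ≤ ∫ y in T, x.2 / π * (dist x y)⁻¹ :=
        setIntegral_mono_on (hT.integrableOn_G hx) (hi.const_mul _) hT.measurableSet
          fun y hy => G_le_inv_dist hx (hT.subset hy)
    _ = x.2 / π * ∫ y in T, (dist x y)⁻¹ := integral_const_mul _ _
    _ ≤ _ := by
      have := setIntegral_inv_dist_le hT.measurableSet hT.volume_ne_top x
      gcongr

lemma IsPatch.interaction_symm {S T : Set (ℝ × ℝ)} (hS : IsPatch S) (hT : IsPatch T) :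
    ∫ x in S, pot T x = ∫ x in T, pot S x := by
  unfold pot
  rw [integral_integral_swap (hS.integrable_G_prod hT)]
  simp only [fun x y => G_symm y x]

lemma IsPatch.interaction_nonneg {S T : Set (ℝ × ℝ)} (hS : IsPatch S) (hT : IsPatch T) :
    0 ≤ ∫ x in S, pot T x :=
  setIntegral_nonneg hS.measurableSet fun _ hx => hT.pot_nonneg (hS.subset hx)

lemma IsPatch.pot_union {S T : Set (ℝ × ℝ)} (hS : IsPatch S) (hT : IsPatch T)
    (hd : Disjoint S T) {x : ℝ × ℝ} (hx : x ∈ H) : pot (S ∪ T) x = pot S x + pot T x :=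
  setIntegral_union hd hT.measurableSet (hS.integrableOn_G hx) (hT.integrableOn_G hx)

lemma IsPatch.interaction_union_right {S T U : Set (ℝ × ℝ)} (hS : IsPatch S) (hT : IsPatch T)
    (hU : IsPatch U) (hd : Disjoint S T) :
    ∫ x in U, pot (S ∪ T) x = (∫ x in U, pot S x) + ∫ x in U, pot T x := by
  rw [← integral_add (hU.integrableOn_pot hS) (hU.integrableOn_pot hT)]
  exact setIntegral_congr_fun hU.measurableSet fun x hx => hS.pot_union hT hd (hU.subset hx)

lemma IsPatch.interaction_union_self {S T : Set (ℝ × ℝ)} (hS : IsPatch S) (hT : IsPatch T)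
    (hd : Disjoint S T) :
    ∫ x in S ∪ T, pot (S ∪ T) x =
      (∫ x in S, pot S x) + 2 * (∫ x in T, pot S x) + ∫ x in T, pot T x := by
  rw [setIntegral_union hd hT.measurableSet (hS.integrableOn_pot (hS.union hT))
    (hT.integrableOn_pot (hS.union hT)), hS.interaction_union_right hT hS hd,
    hS.interaction_union_right hT hT hd, hS.interaction_symm hT]
  ring

lemma continuousAt_G_left {x y : ℝ × ℝ} (hx : x ∈ H) (hy : y ∈ H) (hxy : x ≠ y) :
    ContinuousAt (fun z => G z y) x := by
  have hx' : 0 < x.2 := hx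
  have hy' : 0 < y.2 := hy
  have h1 : 0 < (x.1 - y.1) ^ 2 + (x.2 - y.2) ^ 2 :=
    (pow_pos (dist_pos.2 hxy) 2).trans_le (dist_sq_le x y)
  have h2 : 0 < 4 * x.2 * y.2 / ((x.1 - y.1) ^ 2 + (x.2 - y.2) ^ 2) := by positivity
  unfold G
  refine ContinuousAt.mul continuousAt_const (ContinuousAt.log ?_ (by positivity))
  exact continuousAt_const.add (ContinuousAt.div (by fun_prop) (by fun_prop) h1.ne')

lemma IsPatch.pot_sub_truncated_le {T : Set (ℝ × ℝ)} (hT : IsPatch T) {x : ℝ × ℝ} (hx : x ∈ H)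
    {n : ℝ} (hn : 0 < n) :
    |(∫ y in T, min (G x y) n) - pot T x| ≤ 8 / π ^ 2 * x.2 ^ 2 / n := by
  have hx' : 0 < x.2 := hx
  have hpi := Real.pi_pos
  set r := x.2 / (π * n) with hr
  have hr0 : 0 < r := by positivity
  have hG := hT.integrableOn_G hx
  have hmin : IntegrableOn (fun y => min (G x y) n) T := by
    refine hG.mono' ((measurable_G_right x).min measurable_const).aestronglyMeasurable ?_
    refine (ae_restrict_iff' hT.measurableSet).2 (ae_of_all _ fun y hy => ?_)
    rw [Real.norm_of_nonneg (le_min (G_nonneg hx (hT.subset hy)) hn.le)]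
    exact min_le_left _ _
  have hb : MeasurableSet (Metric.ball x r) := Metric.isOpen_ball.measurableSet
  have hint : IntegrableOn
      ((Metric.ball x r).indicator fun y => x.2 / π * (dist x y)⁻¹) T :=
    (((integrableOn_inv_dist hT.measurableSet hT.volume_ne_top x).const_mul _).indicator hb)
  rw [pot, abs_sub_comm, abs_of_nonneg (sub_nonneg.2
    (setIntegral_mono_on hmin hG hT.measurableSet fun y _ => min_le_left _ _)),
    ← integral_sub hG hmin]
  calc ∫ y in T, (G x y - min (G x y) n)
      ≤ ∫ y in T, (Metric.ball x r).indicator (fun y => x.2 / π * (dist x y)⁻¹) y := by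
        refine setIntegral_mono_on (hG.sub hmin) hint hT.measurableSet fun y hy => ?_
        have hle := G_le_inv_dist hx (hT.subset hy)
        have h0 := G_nonneg hx (hT.subset hy)
        by_cases h : y ∈ Metric.ball x r
        · rw [indicator_of_mem h]
          have : 0 ≤ min (G x y) n := le_min h0 hn.le
          linarith
        · rw [indicator_of_notMem h]
          rw [Metric.mem_ball, not_lt, dist_comm] at h
          have : G x y ≤ n := by
            calc G x y ≤ x.2 / π * (dist x y)⁻¹ := hle
              _ ≤ x.2 / π * r⁻¹ := by gcongr
              _ = n := by rw [hr]; field_simp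
          rw [min_eq_left this]; simp
    _ = x.2 / π * ∫ y in T ∩ Metric.ball x r, (dist x y)⁻¹ := by
        rw [setIntegral_indicator hb, integral_const_mul]
    _ ≤ x.2 / π * (8 * r) := by
        gcongr
        exact setIntegral_inv_dist_inter_ball_le T x hr0.le
    _ = _ := by rw [hr]; field_simp

lemma isOpen_H : IsOpen H := isOpen_lt continuous_const continuous_snd

lemma IsPatch.continuousAt_truncated {T : Set (ℝ × ℝ)} (hT : IsPatch T) {x : ℝ × ℝ}
    (hx : x ∈ H) {n : ℝ} (hn : 0 < n) :
    ContinuousAt (fun z => ∫ y in T, min (G z y) n) x := by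
  refine continuousAt_of_dominated (bound := fun _ => n) ?_ ?_ ?_ ?_
  · exact Eventually.of_forall fun z =>
      ((measurable_G_right z).min measurable_const).aestronglyMeasurable
  · filter_upwards [isOpen_H.mem_nhds hx] with z hz
    refine (ae_restrict_iff' hT.measurableSet).2 (ae_of_all _ fun y hy => ?_)
    rw [Real.norm_of_nonneg (le_min (G_nonneg hz (hT.subset hy)) hn.le)]
    exact min_le_right _ _
  · exact integrableOn_const hT.volume_ne_top
  · refine (ae_restrict_iff' hT.measurableSet).2 ?_
    have : ∀ᵐ y : ℝ × ℝ, y ≠ x := by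
      rw [ae_iff]; simp
    filter_upwards [this] with y hyx hy
    exact (continuousAt_G_left hx (hT.subset hy) hyx.symm).min continuousAt_const

lemma IsPatch.continuousOn_pot {T : Set (ℝ × ℝ)} (hT : IsPatch T) : ContinuousOn (pot T) H := by
  intro x hx
  refine ContinuousAt.continuousWithinAt ?_
  have hx' : 0 < x.2 := hx
  have hpi := Real.pi_pos
  refine continuousAt_of_locally_uniform_approx_of_continuousAt fun u hu => ?_
  obtain ⟨ε, hε, hu⟩ := Metric.mem_uniformity_dist.1 hu
  set n := 8 / π ^ 2 * (2 * x.2) ^ 2 / ε * 2 with hn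
  have hn0 : 0 < n := by positivity
  refine ⟨H ∩ {z | z.2 < 2 * x.2}, ?_, fun z => ∫ y in T, min (G z y) n,
    hT.continuousAt_truncated hx hn0, ?_⟩
  · exact Filter.inter_mem (isOpen_H.mem_nhds hx)
      ((isOpen_lt continuous_snd continuous_const).mem_nhds (by simp; linarith))
  · rintro z ⟨hz, hz2⟩
    have hz' : 0 < z.2 := hz
    apply hu
    rw [dist_comm, Real.dist_eq]
    have hz2 : z.2 < 2 * x.2 := hz2
    calc _ ≤ 8 / π ^ 2 * z.2 ^ 2 / n := hT.pot_sub_truncated_le hz hn0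
      _ ≤ 8 / π ^ 2 * (2 * x.2) ^ 2 / n := by gcongr
      _ = ε / 2 := by rw [hn]; field_simp
      _ < ε := by linarith

/-! ### The flux constant vanishes when the area constraint is inactive -/

/-- `A` maximizes the interaction energy among patches of area at most one with the same
impulse. -/
def IsMaximalPatch (A : Set (ℝ × ℝ)) : Prop :=
  ∀ A', IsPatch A' → (∫ x in A', x.2) = (∫ x in A, x.2) → volume.real A' ≤ 1 →
    ∫ x in A', pot A' x ≤ ∫ x in A, pot A x

lemma volume_real_ball_prod (b : ℝ × ℝ) {r : ℝ} (hr : 0 ≤ r) :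
    volume.real (Metric.ball b r) = 4 * r ^ 2 := by
  rw [show b = (b.1, b.2) from rfl, ← ball_prod_same, Measure.volume_eq_prod,
    measureReal_prod_prod]
  simp only [Measure.real, Real.volume_ball]
  rw [ENNReal.toReal_ofReal (by positivity)]
  ring

lemma setIntegral_snd_ball (b : ℝ × ℝ) {r : ℝ} (hr : 0 ≤ r) :
    ∫ x in Metric.ball b r, x.2 = 4 * r ^ 2 * b.2 := by
  rw [show b = (b.1, b.2) from rfl, ← ball_prod_same, Measure.volume_eq_prod]
  have h := setIntegral_prod_mul (μ := (volume : Measure ℝ)) (ν := (volume : Measure ℝ))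
    (fun _ => (1 : ℝ)) (fun y => y) (Metric.ball b.1 r) (Metric.ball b.2 r)
  simp only [one_mul] at h
  rw [h, Real.ball_eq_Ioo, Real.ball_eq_Ioo, ← integral_Ioc_eq_integral_Ioo,
    ← integral_Ioc_eq_integral_Ioo, ← intervalIntegral.integral_of_le (by linarith),
    ← intervalIntegral.integral_of_le (by linarith), integral_id]
  simp; ring

lemma isPatch_ball {b : ℝ × ℝ} {r : ℝ} (h : Metric.ball b r ⊆ H) : IsPatch (Metric.ball b r) := by
  refine ⟨Metric.isOpen_ball.measurableSet, h, measure_ball_lt_top.ne, ?_⟩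
  refine Measure.integrableOn_of_bounded (M := |b.2| + r) measure_ball_lt_top.ne
    measurable_snd.aestronglyMeasurable ?_
  refine (ae_restrict_iff' Metric.isOpen_ball.measurableSet).2 (ae_of_all _ fun y hy => ?_)
  have h1 := abs_snd_sub_le_dist y b
  have h2 : dist y b < r := hy
  have h3 := abs_sub_abs_le_abs_sub y.2 b.2
  rw [Real.norm_eq_abs]
  linarith

/-- Exchanging a subset `C` of `A` against a disjoint set `B`. -/
lemma IsPatch.interaction_exchange {A B C : Set (ℝ × ℝ)} (hA : IsPatch A) (hB : IsPatch B)
    (hC : IsPatch C) (hCA : C ⊆ A) (hBA : Disjoint A B) :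
    (∫ x in A, pot A x) + 2 * ((∫ x in B, pot A x) - (∫ x in C, pot A x) - ∫ x in B, pot C x) ≤
      ∫ x in A \ C ∪ B, pot (A \ C ∪ B) x := by
  have hA0 : IsPatch (A \ C) := hA.mono (hA.measurableSet.diff hC.measurableSet) sdiff_subset
  have hd : Disjoint (A \ C) C := disjoint_sdiff_left
  have hAu : A = A \ C ∪ C := (sdiff_union_of_subset hCA).symm
  have e1 : ∫ x in A, pot A x = (∫ x in A \ C, pot (A \ C) x) + 2 * (∫ x in C, pot (A \ C) x)
      + ∫ x in C, pot C x := by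
    conv_lhs => rw [hAu]
    exact hA0.interaction_union_self hC hd
  have e2 : ∫ x in C, pot A x = (∫ x in C, pot (A \ C) x) + ∫ x in C, pot C x := by
    conv_lhs => rw [hAu]
    exact hA0.interaction_union_right hC hC hd
  have e3 : ∫ x in B, pot A x = (∫ x in B, pot (A \ C) x) + ∫ x in B, pot C x := by
    conv_lhs => rw [hAu]
    exact hA0.interaction_union_right hC hB hd
  have e4 := hA0.interaction_union_self hB (hBA.mono_left sdiff_subset)
  have e5 := hC.interaction_nonneg hC
  have e6 := hB.interaction_nonneg hB
  linarith

lemma IsPatch.isOpen_levelSet {A : Set (ℝ × ℝ)} (hA : IsPatch A) (W γ : ℝ) :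
    ContinuousOn (fun x : ℝ × ℝ => pot A x - W * x.2 - γ) H ∧
      IsOpen {x ∈ H | 0 < pot A x - W * x.2 - γ} := by
  have h : ContinuousOn (fun x : ℝ × ℝ => pot A x - W * x.2 - γ) H :=
    (hA.continuousOn_pot.sub (by fun_prop)).sub continuousOn_const
  exact ⟨h, h.isOpen_inter_preimage isOpen_H isOpen_Ioi⟩

/-- Arbitrarily close to the boundary of the level set, the stream function takes small positive
values at a definite height above the places where it takes small negative values. -/
lemma IsPatch.exists_near_boundary {A : Set (ℝ × ℝ)} (hA : IsPatch A) {W γ : ℝ} (hW : 0 < W)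
    (hγ : 0 < γ) (hAeq : A = {x ∈ H | 0 < pot A x - W * x.2 - γ}) (hne : A.Nonempty)
    (hv : volume.real A < 1) :
    ∃ h > 0, ∃ η > 0, ∀ ε > 0, ∃ b ∈ H, ∃ c ∈ H, b.2 ≤ h ∧ h + η ≤ c.2 ∧
      pot A b - W * b.2 - γ ∈ Ioo (-ε) 0 ∧ pot A c - W * c.2 - γ ∈ Ioo 0 ε := by
  obtain ⟨hcont, hopen⟩ := hA.isOpen_levelSet W γ
  rw [← hAeq] at hopen
  set f := fun x : ℝ × ℝ => pot A x - W * x.2 - γ with hf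
  have hpi := Real.pi_pos
  obtain ⟨a, ha⟩ := hne
  have ha2 : 0 < a.2 := hA.subset ha
  obtain ⟨e, he, hball⟩ := Metric.isOpen_iff.1 hopen a ha
  have ha' : (a.1, a.2 + e / 2) ∈ A := by
    apply hball
    rw [Metric.mem_ball, Prod.dist_eq]
    simp [abs_of_pos he, he]
  have pos : ∀ {x}, x ∈ A → 0 < f x := fun {x} hx => by rw [hAeq] at hx; exact hx.2
  refine ⟨a.2, ha2, e / 2, by positivity, fun ε hε => ?_⟩
  have hlow : ∃ b ∈ H, b.2 ≤ a.2 ∧ f b ∈ Ioo (-ε) 0 := by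
    have hconv : Convex ℝ {x : ℝ × ℝ | x.2 ∈ Ioc 0 a.2} :=
      (convex_Ioc 0 a.2).is_linear_preimage (f := Prod.snd) ⟨fun _ _ => rfl, fun _ _ => rfl⟩
    set t := min a.2 (γ * π / (2 * (8 + volume.real A))) with ht
    have ht0 : 0 < t := lt_min ha2 (by positivity)
    have hz : (a.1, t) ∈ H := ht0
    have hfz : f (a.1, t) < 0 := by
      have h1 := hA.pot_le hz
      have h2 : t / π * (8 + volume.real A) ≤ γ / 2 := by
        calc t / π * (8 + volume.real A)
            ≤ γ * π / (2 * (8 + volume.real A)) / π * (8 + volume.real A) := by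
              gcongr; exact min_le_right _ _
          _ = γ / 2 := by field_simp
      have h3 : 0 < W * t := by positivity
      simp only [hf] at h1 ⊢
      linarith
    have hmem : max (-ε) (f (a.1, t)) / 2 ∈ Icc (f (a.1, t)) (f a) := by
      have := pos ha
      constructor
      · have := le_max_right (-ε) (f (a.1, t)); linarith
      · have : max (-ε) (f (a.1, t)) < 0 := max_lt (by linarith) hfz
        linarith
    obtain ⟨b, hb, hfb⟩ := hconv.isPreconnected.intermediate_value
      (show (a.1, t) ∈ {x : ℝ × ℝ | x.2 ∈ Ioc 0 a.2} from ⟨ht0, min_le_left _ _⟩)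
      (show a ∈ {x : ℝ × ℝ | x.2 ∈ Ioc 0 a.2} from ⟨ha2, le_rfl⟩)
      (hcont.mono fun x hx => hx.1) hmem
    refine ⟨b, hb.1, hb.2, ?_⟩
    rw [hfb]
    have : max (-ε) (f (a.1, t)) < 0 := max_lt (by linarith) hfz
    have := le_max_left (-ε) (f (a.1, t))
    constructor <;> linarith
  have hhigh : ∃ c ∈ H, a.2 + e / 2 ≤ c.2 ∧ f c ∈ Ioo 0 ε := by
    have hconv : Convex ℝ {x : ℝ × ℝ | x.2 ∈ Ici (a.2 + e / 2)} :=
      (convex_Ici (a.2 + e / 2)).is_linear_preimage (f := Prod.snd)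
        ⟨fun _ _ => rfl, fun _ _ => rfl⟩
    have hsub : {x : ℝ × ℝ | x.2 ∈ Ici (a.2 + e / 2)} ⊆ H := fun x hx =>
      lt_of_lt_of_le (by positivity) (show a.2 + e / 2 ≤ x.2 from hx)
    obtain ⟨z, hz, hzA⟩ : ∃ z ∈ {x : ℝ × ℝ | x.2 ∈ Ici (a.2 + e / 2)}, z ∉ A := by
      by_contra! hcon
      have h1 : Metric.ball (0, a.2 + e / 2 + 1) 1 ⊆ A := fun x hx => hcon x (by
        have h2 := abs_lt.1 ((abs_snd_sub_le_dist x _).trans_lt hx)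
        simp only [mem_ofPred_eq, mem_Ici]
        linarith [h2.1])
      have h2 := measureReal_mono h1 hA.volume_ne_top
      rw [volume_real_ball_prod _ zero_le_one] at h2
      linarith
    have hfz : f z ≤ 0 := by
      by_contra! hcon
      exact hzA (by rw [hAeq]; exact ⟨hsub hz, hcon⟩)
    have hmin : 0 < min ε (f (a.1, a.2 + e / 2)) := lt_min hε (pos ha')
    have hmem : min ε (f (a.1, a.2 + e / 2)) / 2 ∈ Icc (f z) (f (a.1, a.2 + e / 2)) := by
      have := min_le_right ε (f (a.1, a.2 + e / 2))
      constructor <;> linarith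
    obtain ⟨c, hc, hfc⟩ := hconv.isPreconnected.intermediate_value hz
      (show (a.1, a.2 + e / 2) ∈ {x : ℝ × ℝ | x.2 ∈ Ici (a.2 + e / 2)} from
        le_refl (a.2 + e / 2))
      (hcont.mono hsub) hmem
    refine ⟨c, hsub hc, hc, ?_⟩
    rw [hfc]
    have := min_le_left ε (f (a.1, a.2 + e / 2))
    constructor <;> linarith
  obtain ⟨b, hb, hb1, hb2⟩ := hlow
  obtain ⟨c, hc, hc1, hc2⟩ := hhigh
  exact ⟨b, hb, c, hc, hb1, hc1, hb2, hc2⟩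

lemma IsPatch.flux_eq_zero_of_volume_lt_one {A : Set (ℝ × ℝ)} (hA : IsPatch A) {W γ : ℝ}
    (hW : 0 < W) (hγ : 0 ≤ γ) (hAeq : A = {x ∈ H | 0 < pot A x - W * x.2 - γ})
    (hne : A.Nonempty) (hv : volume.real A < 1) (hmax : IsMaximalPatch A) : γ = 0 := by
  by_contra hγ0
  replace hγ : 0 < γ := lt_of_le_of_ne hγ (Ne.symm hγ0)
  have hpi := Real.pi_pos
  obtain ⟨h, hh, η, hη, H1⟩ := hA.exists_near_boundary hW hγ hAeq hne hv
  have hcont := (hA.isOpen_levelSet W γ).1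
  set q := h / (h + η) with hq
  have hq1 : q < 1 := by rw [hq, div_lt_one (by positivity)]; linarith
  have hq0 : 0 < q := by positivity
  set ε := γ * (1 - q) / 4 with hε
  have hε0 : 0 < ε := by have := sub_pos.2 hq1; positivity
  obtain ⟨b, hb, c, hc, hbh, hhc, hfb, hfc⟩ := H1 ε hε0
  have hb' : 0 < b.2 := hb
  have hc' : 0 < c.2 := hc
  obtain ⟨eb, heb, hBsub⟩ := Metric.isOpen_iff.1
    (hcont.isOpen_inter_preimage isOpen_H (isOpen_Ioo (a := -ε) (b := 0))) b ⟨hb, hfb⟩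
  obtain ⟨ec, hec, hCsub⟩ := Metric.isOpen_iff.1
    (hcont.isOpen_inter_preimage isOpen_H (isOpen_Ioo (a := 0) (b := ε))) c ⟨hc, hfc⟩
  set K := 2 * (h + η) / (π * η) with hK
  have hK0 : 0 < K := by positivity
  obtain ⟨τ, hτ, hτb, hτc, hτη, hτv, hτK⟩ : ∃ τ > 0, τ < eb ∧ τ < ec ∧ τ < η / 4 ∧
      4 * τ ^ 2 < 1 - volume.real A ∧ K * (4 * τ ^ 2) < γ * (1 - q) / 2 := by
    have t1 : Tendsto (fun τ : ℝ => 4 * τ ^ 2) (𝓝[>] 0) (𝓝 0) := by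
      have : Continuous fun τ : ℝ => 4 * τ ^ 2 := by fun_prop
      simpa using (this.tendsto 0).mono_left nhdsWithin_le_nhds
    have t0 : Tendsto (fun τ : ℝ => τ) (𝓝[>] 0) (𝓝 0) := tendsto_id.mono_left nhdsWithin_le_nhds
    have t2 := t1.const_mul K
    rw [mul_zero] at t2
    have := (self_mem_nhdsWithin : Ioi (0 : ℝ) ∈ 𝓝[>] 0)
    obtain ⟨τ, h1, h2, h3, h4, h5, h6⟩ := (((eventually_mem_set.2 this).and
      ((t0.eventually_lt_const heb).and ((t0.eventually_lt_const hec).and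
      ((t0.eventually_lt_const (show 0 < η / 4 by positivity)).and
      ((t1.eventually_lt_const (sub_pos.2 hv)).and
      (t2.eventually_lt_const (show 0 < γ * (1 - q) / 2 by linarith))))))).exists)
    exact ⟨τ, h1, h2, h3, h4, h5, h6⟩
  set σ := τ * √(b.2 / c.2) with hσ
  have hbc : b.2 / c.2 ≤ q := by rw [hq]; gcongr
  have hσ0 : 0 < σ := by positivity
  have hσ2 : σ ^ 2 = τ ^ 2 * (b.2 / c.2) := by
    rw [hσ, mul_pow, Real.sq_sqrt (by positivity)]
  have hστ : σ ≤ τ := by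
    rw [← pow_le_pow_iff_left₀ hσ0.le hτ.le two_ne_zero, hσ2]
    exact mul_le_of_le_one_right (by positivity) (hbc.trans hq1.le)
  set B := Metric.ball b τ with hBdef
  set C := Metric.ball c σ with hCdef
  replace hBsub := (Metric.ball_subset_ball hτb.le).trans hBsub
  replace hCsub := (Metric.ball_subset_ball (hστ.trans hτc.le)).trans hCsub
  have hB : IsPatch B := isPatch_ball fun x hx => (hBsub hx).1
  have hC : IsPatch C := isPatch_ball fun x hx => (hCsub hx).1
  have hCA : C ⊆ A := fun x hx => by rw [hAeq]; exact ⟨(hCsub hx).1, (hCsub hx).2.1⟩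
  have hAB : Disjoint A B := by
    rw [disjoint_left]
    intro x hx hxB
    rw [hAeq] at hx
    exact lt_asymm hx.2 (hBsub hxB).2.2
  have hvB : volume.real B = 4 * τ ^ 2 := volume_real_ball_prod b hτ.le
  have hvC : volume.real C = 4 * σ ^ 2 := volume_real_ball_prod c hσ0.le
  have hIB : ∫ x in B, x.2 = 4 * τ ^ 2 * b.2 := setIntegral_snd_ball b hτ.le
  have hIC : ∫ x in C, x.2 = 4 * τ ^ 2 * b.2 := by
    rw [setIntegral_snd_ball c hσ0.le, hσ2]; field_simp
  have hA0 : IsPatch (A \ C) := hA.mono (hA.measurableSet.diff hC.measurableSet) sdiff_subset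
  have hkey := hmax (A \ C ∪ B) (hA0.union hB) (by
    rw [setIntegral_union (hAB.mono_left sdiff_subset) hB.measurableSet hA0.integrableOn_snd
      hB.integrableOn_snd, hIB, setIntegral_sdiff hC.measurableSet hA.integrableOn_snd hCA, hIC]
    ring) (by
    have h1 := measureReal_union_le (μ := volume) (A \ C) B
    have h2 := measureReal_mono (sdiff_subset : A \ C ⊆ A) hA.volume_ne_top
    linarith)
  have hex := hA.interaction_exchange hB hC hCA hAB
  have hlow : W * (4 * τ ^ 2 * b.2) + (γ - ε) * (4 * τ ^ 2) ≤ ∫ x in B, pot A x := by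
    rw [← hIB, ← hvB, ← integral_const_mul]
    have hconst : ∫ x in B, (γ - ε) = (γ - ε) * volume.real B := by simp [mul_comm]
    rw [← hconst, ← integral_add (hB.integrableOn_snd.const_mul W)
      (integrableOn_const hB.volume_ne_top)]
    refine setIntegral_mono_on ((hB.integrableOn_snd.const_mul W).add
      (integrableOn_const hB.volume_ne_top)) (hB.integrableOn_pot hA) hB.measurableSet ?_
    intro x hx
    have := (hBsub hx).2.1
    linarith
  have hupp : ∫ x in C, pot A x ≤ W * (4 * τ ^ 2 * b.2) + (γ + ε) * (4 * σ ^ 2) := by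
    rw [← hIC, ← hvC, ← integral_const_mul]
    have hconst : ∫ x in C, (γ + ε) = (γ + ε) * volume.real C := by simp [mul_comm]
    rw [← hconst, ← integral_add (hC.integrableOn_snd.const_mul W)
      (integrableOn_const hC.volume_ne_top)]
    refine setIntegral_mono_on (hC.integrableOn_pot hA) ((hC.integrableOn_snd.const_mul W).add
      (integrableOn_const hC.volume_ne_top)) hC.measurableSet ?_
    intro x hx
    have := (hCsub hx).2.2
    linarith
  have hcross : ∫ x in B, pot C x ≤ K * (4 * σ ^ 2) * (4 * τ ^ 2) := by
    have h1 : ∀ x ∈ B, pot C x ≤ K * (4 * σ ^ 2) := by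
      intro x hx
      have hxH := hB.subset hx
      have hconst : ∫ y in C, K = K * (4 * σ ^ 2) := by rw [← hvC]; simp [mul_comm]
      rw [← hconst]
      refine setIntegral_mono_on (hC.integrableOn_G hxH) (integrableOn_const hC.volume_ne_top)
        hC.measurableSet fun y hy => ?_
      have hxb := abs_lt.1 ((abs_snd_sub_le_dist x b).trans_lt hx)
      have hyc := abs_lt.1 ((abs_snd_sub_le_dist y c).trans_lt hy)
      have hxy := (abs_le.1 (abs_snd_sub_le_dist x y)).1
      have hd : η / 2 ≤ dist x y := by linarith
      have hx2 : x.2 ≤ h + η := by linarith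
      have hx2' : 0 < x.2 := hxH
      calc G x y ≤ x.2 / π * (dist x y)⁻¹ := G_le_inv_dist hxH (hC.subset hy)
        _ ≤ (h + η) / π * (η / 2)⁻¹ := by gcongr
        _ = K := by rw [hK]; field_simp
    have hconst : ∫ x in B, K * (4 * σ ^ 2) = K * (4 * σ ^ 2) * (4 * τ ^ 2) := by
      rw [← hvB]; simp [mul_comm]
    rw [← hconst]
    exact setIntegral_mono_on (hB.integrableOn_pot hC) (integrableOn_const hB.volume_ne_top)
      hB.measurableSet h1
  have hσq : 4 * σ ^ 2 ≤ q * (4 * τ ^ 2) := by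
    rw [hσ2]
    have : τ ^ 2 * (b.2 / c.2) ≤ τ ^ 2 * q := by gcongr
    linarith
  have hσ4 : 4 * σ ^ 2 ≤ 4 * τ ^ 2 := by
    have : σ ^ 2 ≤ τ ^ 2 := by gcongr
    linarith
  have hv4 : 0 < 4 * τ ^ 2 := by positivity
  have e1 : (γ + ε) * (4 * σ ^ 2) ≤ (γ + ε) * (q * (4 * τ ^ 2)) := by gcongr
  have e2 : K * (4 * σ ^ 2) * (4 * τ ^ 2) ≤ K * (4 * τ ^ 2) * (4 * τ ^ 2) := by gcongr
  have e3 : 0 < (4 * τ ^ 2) * (γ * (1 - q) / 2 - K * (4 * τ ^ 2)) :=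
    mul_pos hv4 (by linarith)
  have e4 : ε * (q * (4 * τ ^ 2)) ≤ ε * (4 * τ ^ 2) := by
    have : q * (4 * τ ^ 2) ≤ 4 * τ ^ 2 := mul_le_of_le_one_left hv4.le hq1.le
    gcongr
  have e5 : (4 * τ ^ 2) * (γ * (1 - q) / 2) = (4 * τ ^ 2) * (2 * ε) := by rw [hε]; ring
  have e6 : γ * (4 * τ ^ 2) - γ * (q * (4 * τ ^ 2)) = (4 * τ ^ 2) * (4 * ε) := by rw [hε]; ring
  linarith

/-! ### Patches of unit area and small impulse -/

lemma isPatch_test_ball {s : ℝ} (hs : 0 < s) : IsPatch (Metric.ball ((0, 2 * s) : ℝ × ℝ) s) := by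
  refine isPatch_ball fun x hx => ?_
  have := abs_lt.1 ((abs_snd_sub_le_dist x _).trans_lt hx)
  change 0 < x.2
  simp only at this
  linarith [this.1]

lemma interaction_test_ball {s : ℝ} (hs : 0 < s) :
    4 * s ^ 4 / (3 * π) ≤ ∫ x in Metric.ball ((0, 2 * s) : ℝ × ℝ) s,
      pot (Metric.ball (0, 2 * s) s) x := by
  have hpi := Real.pi_pos
  have hP := isPatch_test_ball hs
  set P := Metric.ball ((0, 2 * s) : ℝ × ℝ) s with hPdef
  have hvP : volume.real P = 4 * s ^ 2 := volume_real_ball_prod _ hs.le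
  have hG : ∀ x ∈ P, ∀ y ∈ P, 1 / (12 * π) ≤ G x y ∨ x = y := by
    intro x hx y hy
    refine (eq_or_ne x y).symm.imp (fun hxy => ?_) id
    have hx1 := abs_lt.1 ((abs_fst_sub_le_dist x _).trans_lt hx)
    have hx2 := abs_lt.1 ((abs_snd_sub_le_dist x _).trans_lt hx)
    have hy1 := abs_lt.1 ((abs_fst_sub_le_dist y _).trans_lt hy)
    have hy2 := abs_lt.1 ((abs_snd_sub_le_dist y _).trans_lt hy)
    simp only [sub_zero] at hx1 hx2 hy1 hy2
    have hρ : 0 < (x.1 - y.1) ^ 2 + (x.2 - y.2) ^ 2 :=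
      (pow_pos (dist_pos.2 hxy) 2).trans_le (dist_sq_le x y)
    have h1 : (x.1 - y.1) ^ 2 ≤ (2 * s) ^ 2 := sq_le_sq' (by linarith) (by linarith)
    have h2 : (x.2 - y.2) ^ 2 ≤ (2 * s) ^ 2 := sq_le_sq' (by linarith) (by linarith)
    have h3 : s * s ≤ x.2 * y.2 := by
      apply mul_le_mul <;> linarith
    have h4 : 1 / 2 ≤ 4 * x.2 * y.2 / ((x.1 - y.1) ^ 2 + (x.2 - y.2) ^ 2) := by
      rw [le_div_iff₀ hρ]; linarith
    have h5 : 1 / 3 ≤ Real.log (1 + 4 * x.2 * y.2 / ((x.1 - y.1) ^ 2 + (x.2 - y.2) ^ 2)) := by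
      calc (1 : ℝ) / 3 = 1 - (1 + 1 / 2)⁻¹ := by norm_num
        _ ≤ Real.log (1 + 1 / 2) := Real.one_sub_inv_le_log_of_pos (by norm_num)
        _ ≤ _ := by gcongr
    unfold G
    calc 1 / (12 * π) = 1 / (4 * π) * (1 / 3) := by field_simp; norm_num
      _ ≤ _ := by gcongr
  have hpot : ∀ x ∈ P, 1 / (12 * π) * (4 * s ^ 2) ≤ pot P x := by
    intro x hx
    have hconst : ∫ y in P, 1 / (12 * π) = 1 / (12 * π) * (4 * s ^ 2) := by
      rw [← hvP]; simp [mul_comm]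
    rw [← hconst]
    refine setIntegral_mono_on_ae (integrableOn_const hP.volume_ne_top)
      (hP.integrableOn_G (hP.subset hx)) hP.measurableSet ?_
    have : ∀ᵐ y : ℝ × ℝ, y ≠ x := by rw [ae_iff]; simp
    filter_upwards [this] with y hyx hy
    exact (hG x hx y hy).resolve_right hyx.symm
  have hconst : ∫ x in P, 1 / (12 * π) * (4 * s ^ 2) =
      1 / (12 * π) * (4 * s ^ 2) * (4 * s ^ 2) := by
    conv_rhs => enter [2]; rw [← hvP]
    rw [setIntegral_const, smul_eq_mul, mul_comm]
  calc 4 * s ^ 4 / (3 * π) = 1 / (12 * π) * (4 * s ^ 2) * (4 * s ^ 2) := by field_simp; norm_num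
    _ = _ := hconst.symm
    _ ≤ _ := setIntegral_mono_on (integrableOn_const hP.volume_ne_top) (hP.integrableOn_pot hP)
      hP.measurableSet hpot

lemma IsPatch.exists_pot_gt {A : Set (ℝ × ℝ)} (hA : IsPatch A) (hmax : IsMaximalPatch A) {s : ℝ}
    (hs : 0 < s) (hs1 : s ≤ 1 / 2) (hM : ∫ x in A, x.2 = 8 * s ^ 3) :
    ∃ x ∈ A, x.2 / π * (s / 12) < pot A x := by
  have hpi := Real.pi_pos
  by_contra! hcon
  have hP := isPatch_test_ball hs
  have h1 := hmax _ hP (by rw [setIntegral_snd_ball _ hs.le, hM]; ring)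
    (by rw [volume_real_ball_prod _ hs.le]; nlinarith)
  have h2 := interaction_test_ball hs
  have h3 : ∫ x in A, pot A x ≤ ∫ x in A, s / (12 * π) * x.2 :=
    setIntegral_mono_on (hA.integrableOn_pot hA) (hA.integrableOn_snd.const_mul _)
      hA.measurableSet fun x hx => (hcon x hx).trans (le_of_eq (by field_simp))
  rw [integral_const_mul, hM] at h3
  have h4 : s / (12 * π) * (8 * s ^ 3) < 4 * s ^ 4 / (3 * π) := by
    have : s / (12 * π) * (8 * s ^ 3) = 4 * s ^ 4 / (3 * π) / 2 := by field_simp; norm_num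
    have h5 : 0 < 4 * s ^ 4 / (3 * π) := by positivity
    linarith
  linarith

/-- Discarding the vorticity very close to a point where the potential is large. -/
lemma IsPatch.far_field_gt {A : Set (ℝ × ℝ)} (hA : IsPatch A) {s : ℝ} (hs : 0 < s) {x : ℝ × ℝ}
    (hx : x ∈ H) (hpot : x.2 / π * (s / 12) < pot A x) :
    x.2 / π * (s / 24) < ∫ y in A \ Metric.ball x (s / 200), G x y := by
  have hpi := Real.pi_pos
  have hx' : 0 < x.2 := hx
  have hb : MeasurableSet (Metric.ball x (s / 200)) := Metric.isOpen_ball.measurableSet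
  have hnear : ∫ y in A ∩ Metric.ball x (s / 200), G x y ≤ x.2 / π * (8 * (s / 200)) := by
    calc _ ≤ ∫ y in A ∩ Metric.ball x (s / 200), x.2 / π * (dist x y)⁻¹ :=
          setIntegral_mono_on ((hA.integrableOn_G hx).mono_set inter_subset_left)
            (((integrableOn_inv_dist_ball x _).mono_set inter_subset_right).const_mul _)
            (hA.measurableSet.inter hb) fun y hy => G_le_inv_dist hx (hA.subset hy.1)
      _ = x.2 / π * ∫ y in A ∩ Metric.ball x (s / 200), (dist x y)⁻¹ := integral_const_mul _ _
      _ ≤ _ := by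
          have := setIntegral_inv_dist_inter_ball_le A x (show 0 ≤ s / 200 by positivity)
          gcongr
  have hsplit := integral_inter_add_sdiff hb (hA.integrableOn_G hx)
  rw [pot, ← hsplit] at hpot
  have : 0 < x.2 / π * s := by positivity
  linarith

lemma IsPatch.setIntegral_snd_mono {A S : Set (ℝ × ℝ)} (hA : IsPatch A) (hS : S ⊆ A) :
    ∫ y in S, y.2 ≤ ∫ y in A, y.2 := by
  refine setIntegral_mono_set hA.integrableOn_snd ?_ hS.eventuallyLE
  exact (ae_restrict_iff' hA.measurableSet).2 (ae_of_all _ fun y hy => (hA.subset hy).le)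

lemma IsPatch.height_le {A : Set (ℝ × ℝ)} (hA : IsPatch A) {s : ℝ} (hs : 0 < s)
    (hM : ∫ x in A, x.2 = 8 * s ^ 3) {x : ℝ × ℝ} (hx : x ∈ H)
    (hpot : x.2 / π * (s / 12) < pot A x) : x.2 ≤ 2 * (40000 * s) := by
  by_contra! hcon
  have hpi := Real.pi_pos
  have hx' : 0 < x.2 := hx
  have hfar := hA.far_field_gt hs hx hpot
  have hAb := hA.mono (hA.measurableSet.diff Metric.isOpen_ball.measurableSet)
    (sdiff_subset : A \ Metric.ball x (s / 200) ⊆ A)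
  have h1 : ∀ y ∈ A \ Metric.ball x (s / 200), G x y ≤ x.2 / π * (1 / (200 * s ^ 2)) * y.2 := by
    rintro y ⟨hyA, hyb⟩
    rw [Metric.mem_ball, not_lt, dist_comm] at hyb
    have hd : 0 < dist x y := lt_of_lt_of_le (by positivity) hyb
    have hy' : 0 < y.2 := hA.subset hyA
    rw [mul_assoc]
    by_cases h : 40000 * s ≤ y.2
    · refine (G_le_inv_dist hx (hA.subset hyA)).trans ?_
      gcongr
      calc (dist x y)⁻¹ ≤ (s / 200)⁻¹ := by gcongr
        _ = 1 / (200 * s ^ 2) * (40000 * s) := by field_simp; norm_num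
        _ ≤ _ := by gcongr
    · refine (G_le_inv_dist_sq hx (hA.subset hyA)).trans ?_
      have h2 := (abs_le.1 (abs_snd_sub_le_dist x y)).2
      have h3 : 40000 * s ≤ dist x y := by linarith
      have h4 : 200 * s ^ 2 ≤ dist x y ^ 2 := by nlinarith
      gcongr
      calc y.2 / dist x y ^ 2 ≤ y.2 / (200 * s ^ 2) := by gcongr
        _ = _ := by ring
  have h2 : ∫ y in A \ Metric.ball x (s / 200), G x y ≤
      x.2 / π * (1 / (200 * s ^ 2)) * (8 * s ^ 3) := by
    rw [← hM]
    calc _ ≤ ∫ y in A \ Metric.ball x (s / 200), x.2 / π * (1 / (200 * s ^ 2)) * y.2 :=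
          setIntegral_mono_on (hAb.integrableOn_G hx) (hAb.integrableOn_snd.const_mul _)
            hAb.measurableSet h1
      _ = x.2 / π * (1 / (200 * s ^ 2)) * ∫ y in A \ Metric.ball x (s / 200), y.2 :=
          integral_const_mul _ _
      _ ≤ _ := mul_le_mul_of_nonneg_left
          (hA.setIntegral_snd_mono (sdiff_subset : A \ Metric.ball x (s / 200) ⊆ A)) (by positivity)
  have h3 : x.2 / π * (1 / (200 * s ^ 2)) * (8 * s ^ 3) = x.2 / π * (s / 25) := by
    field_simp; norm_num
  have : 0 < x.2 / π * s := by positivity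
  linarith

/-- Concentration of the impulse near a point where the potential is large. -/
lemma IsPatch.impulse_near_ge {A : Set (ℝ × ℝ)} (hA : IsPatch A) {s : ℝ} (hs : 0 < s)
    (hM : ∫ x in A, x.2 = 8 * s ^ 3) {x : ℝ × ℝ} (hx : x ∈ H)
    (hpot : x.2 / π * (s / 12) < pot A x) :
    s ^ 3 / 10 ^ 6 ≤ ∫ y in A ∩ Metric.ball x (40000 * s), y.2 := by
  have hpi := Real.pi_pos
  have hx' : 0 < x.2 := hx
  have hfar := hA.far_field_gt hs hx hpot
  have hb : MeasurableSet (Metric.ball x (40000 * s)) := Metric.isOpen_ball.measurableSet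
  have hAb := hA.mono (hA.measurableSet.diff Metric.isOpen_ball.measurableSet)
    (sdiff_subset : A \ Metric.ball x (s / 200) ⊆ A)
  have hnn : ∀ y ∈ A, 0 ≤ (Metric.ball x (40000 * s)).indicator (fun y : ℝ × ℝ => y.2) y :=
    fun y hy => indicator_apply_nonneg fun _ => (hA.subset hy).le
  have hint : IntegrableOn (fun y : ℝ × ℝ => x.2 / π * (1 / (40000 * s) ^ 2) * y.2 +
      x.2 / π * (1 / (s / 200) ^ 2) *
        (Metric.ball x (40000 * s)).indicator (fun y : ℝ × ℝ => y.2) y) A :=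
    (hA.integrableOn_snd.const_mul _).add ((hA.integrableOn_snd.indicator hb).const_mul _)
  have h1 : ∀ y ∈ A \ Metric.ball x (s / 200), G x y ≤ x.2 / π * (1 / (40000 * s) ^ 2) * y.2 +
      x.2 / π * (1 / (s / 200) ^ 2) *
        (Metric.ball x (40000 * s)).indicator (fun y : ℝ × ℝ => y.2) y := by
    rintro y ⟨hyA, hyb⟩
    rw [Metric.mem_ball, not_lt, dist_comm] at hyb
    have hd : 0 < dist x y := lt_of_lt_of_le (by positivity) hyb
    have hy' : 0 < y.2 := hA.subset hyA
    refine (G_le_inv_dist_sq hx (hA.subset hyA)).trans ?_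
    by_cases h : y ∈ Metric.ball x (40000 * s)
    · rw [indicator_of_mem h]
      have h2 : x.2 / π * (y.2 / dist x y ^ 2) ≤ x.2 / π * (y.2 / (s / 200) ^ 2) := by gcongr
      have h3 : 0 ≤ x.2 / π * (1 / (40000 * s) ^ 2) * y.2 := by positivity
      have h4 : x.2 / π * (y.2 / (s / 200) ^ 2) = x.2 / π * (1 / (s / 200) ^ 2) * y.2 := by ring
      linarith
    · rw [indicator_of_notMem h, mul_zero, add_zero]
      rw [Metric.mem_ball, not_lt, dist_comm] at h
      calc x.2 / π * (y.2 / dist x y ^ 2) ≤ x.2 / π * (y.2 / (40000 * s) ^ 2) := by gcongr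
        _ = _ := by ring
  have h2 : ∫ y in A \ Metric.ball x (s / 200), G x y ≤ x.2 / π * (1 / (40000 * s) ^ 2) *
      (8 * s ^ 3) + x.2 / π * (1 / (s / 200) ^ 2) *
        ∫ y in A ∩ Metric.ball x (40000 * s), y.2 := by
    rw [← hM, ← setIntegral_indicator hb, ← integral_const_mul, ← integral_const_mul,
      ← integral_add (hA.integrableOn_snd.const_mul _)
        ((hA.integrableOn_snd.indicator hb).const_mul _)]
    refine (setIntegral_mono_on (hAb.integrableOn_G hx) (hint.mono_set sdiff_subset)
      hAb.measurableSet h1).trans (setIntegral_mono_set hint ?_ sdiff_subset.eventuallyLE)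
    refine (ae_restrict_iff' hA.measurableSet).2 (ae_of_all _ fun y hy => ?_)
    have hy' : 0 < y.2 := hA.subset hy
    have := hnn y hy
    positivity
  set m := ∫ y in A ∩ Metric.ball x (40000 * s), y.2
  have h3 : x.2 / π * (1 / (40000 * s) ^ 2) * (8 * s ^ 3) = x.2 / π * (s / 200000000) := by
    field_simp; norm_num
  have h4 : x.2 / π * (1 / (s / 200) ^ 2) * m = x.2 / π * (40000 * m / s ^ 2) := by
    field_simp; norm_num; ring
  have h5 : s / 24 < s / 200000000 + 40000 * m / s ^ 2 := by
    rw [h3, h4, ← mul_add] at h2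
    exact lt_of_mul_lt_mul_left (hfar.trans_le h2) (by positivity)
  have h6 : s / 25 < 40000 * m / s ^ 2 := by linarith
  rw [lt_div_iff₀ (by positivity)] at h6
  have : s / 25 * s ^ 2 = s ^ 3 / 25 := by ring
  linarith

lemma IsPatch.exists_notMem_pot_ge {A : Set (ℝ × ℝ)} (hA : IsPatch A) {s : ℝ} (hs : 0 < s)
    (hM : ∫ x in A, x.2 = 8 * s ^ 3) {x : ℝ × ℝ} (hx : x ∈ H)
    (hpot : x.2 / π * (s / 12) < pot A x) :
    ∃ z ∈ H, z ∉ A ∧ z.2 ≤ 8 * (40000 * s) ∧ s ^ 2 / (3 * 10 ^ 14) ≤ pot A z := by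
  have hpi := Real.pi_pos
  have hx' : 0 < x.2 := hx
  have hm := hA.impulse_near_ge hs hM hx hpot
  have hxD := hA.height_le hs hM hx hpot
  set D := 40000 * s with hD
  have hD0 : 0 < D := by positivity
  set P := Metric.ball ((x.1, 6 * D) : ℝ × ℝ) (2 * D) with hP
  have hPz : ∀ z ∈ P, |z.1 - x.1| < 2 * D ∧ 4 * D < z.2 ∧ z.2 < 8 * D := by
    intro z hz
    have h1 := (abs_fst_sub_le_dist z _).trans_lt hz
    have h2 := abs_lt.1 ((abs_snd_sub_le_dist z _).trans_lt hz)
    simp only at h1 h2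
    exact ⟨h1, by linarith [h2.1], by linarith [h2.2]⟩
  obtain ⟨z, hzP, hzA⟩ : ∃ z ∈ P, z ∉ A := by
    by_contra! hcon
    have h1 := hA.setIntegral_snd_mono (show P ⊆ A from hcon)
    rw [setIntegral_snd_ball _ (by positivity), hM] at h1
    have h2 : s ^ 3 ≤ D ^ 3 := by gcongr; rw [hD]; linarith
    have : 0 < D ^ 3 := by positivity
    nlinarith
  obtain ⟨hz1, hz2, hz3⟩ := hPz z hzP
  have hzH : z ∈ H := lt_trans (by positivity) hz2
  have hz' : 0 < z.2 := hzH
  refine ⟨z, hzH, hzA, hz3.le, ?_⟩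
  have hS : IsPatch (A ∩ Metric.ball x D) :=
    hA.mono (hA.measurableSet.inter Metric.isOpen_ball.measurableSet) inter_subset_left
  have hG : ∀ y ∈ A ∩ Metric.ball x D, 1 / (7000 * D) * y.2 ≤ G z y := by
    rintro y ⟨hyA, hyx⟩
    have hy' : 0 < y.2 := hA.subset hyA
    have hy1 := abs_lt.1 ((abs_fst_sub_le_dist y _).trans_lt hyx)
    have hy2 := abs_lt.1 ((abs_snd_sub_le_dist y _).trans_lt hyx)
    have hz1 := abs_lt.1 hz1
    set ρ := (z.1 - y.1) ^ 2 + (z.2 - y.2) ^ 2 with hρ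
    have h1 : (z.1 - y.1) ^ 2 ≤ (3 * D) ^ 2 := sq_le_sq' (by linarith) (by linarith)
    have h2 : (z.2 - y.2) ^ 2 ≤ (8 * D) ^ 2 := sq_le_sq' (by linarith) (by linarith)
    have h3 : D ^ 2 ≤ (z.2 - y.2) ^ 2 := by
      have : D ≤ z.2 - y.2 := by linarith
      gcongr
    have hρ1 : D ^ 2 ≤ ρ := by have := sq_nonneg (z.1 - y.1); linarith
    have hρ0 : 0 < ρ := lt_of_lt_of_le (by positivity) hρ1
    have hρ2 : ρ ≤ 80 * D ^ 2 := by
      have : 0 < D ^ 2 := by positivity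
      linarith
    set σ := 4 * z.2 * y.2 / ρ with hσ
    have hσ0 : 0 < σ := by positivity
    have hσ1 : σ ≤ 96 := by
      rw [hσ, div_le_iff₀ hρ0]
      have : z.2 * y.2 ≤ (8 * D) * (3 * D) := by
        apply mul_le_mul <;> linarith
      nlinarith
    have hσ2 : y.2 / (5 * D) ≤ σ := by
      rw [hσ, div_le_div_iff₀ (by positivity) hρ0]
      have e1 : y.2 * ρ ≤ y.2 * (80 * D ^ 2) := by gcongr
      have e2 : y.2 * D * (4 * D) ≤ y.2 * D * z.2 := by gcongr
      linarith
    have hlog : σ / 97 ≤ Real.log (1 + σ) := by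
      calc σ / 97 ≤ σ / (1 + σ) := by gcongr; linarith
        _ = 1 - (1 + σ)⁻¹ := by field_simp; ring
        _ ≤ _ := Real.one_sub_inv_le_log_of_pos (by positivity)
    have hpi4 : 1 / (14 : ℝ) ≤ 1 / (4 * π) := by
      have := Real.pi_lt_d2
      gcongr; linarith
    unfold G
    calc 1 / (7000 * D) * y.2 ≤ 1 / 14 * ((y.2 / (5 * D)) / 97) := by
          have : 1 / 14 * ((y.2 / (5 * D)) / 97) = 1 / (6790 * D) * y.2 := by field_simp; norm_num
          rw [this]; gcongr; norm_num
      _ ≤ 1 / (4 * π) * Real.log (1 + σ) := by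
          gcongr
          exact le_trans (by gcongr) hlog
  calc s ^ 2 / (3 * 10 ^ 14) ≤ 1 / (7000 * D) * (s ^ 3 / 10 ^ 6) := by
        rw [hD]
        have : 1 / (7000 * (40000 * s)) * (s ^ 3 / 10 ^ 6) = s ^ 2 / (28 * 10 ^ 13) := by
          field_simp; norm_num
        rw [this]
        exact div_le_div_of_nonneg_left (by positivity) (by positivity) (by norm_num)
    _ ≤ 1 / (7000 * D) * ∫ y in A ∩ Metric.ball x D, y.2 := by gcongr
    _ = ∫ y in A ∩ Metric.ball x D, 1 / (7000 * D) * y.2 := (integral_const_mul _ _).symm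
    _ ≤ ∫ y in A ∩ Metric.ball x D, G z y :=
        setIntegral_mono_on (hS.integrableOn_snd.const_mul _) (hS.integrableOn_G hzH)
          hS.measurableSet hG
    _ ≤ pot A z := by
        refine setIntegral_mono_set (hA.integrableOn_G hzH) ?_ inter_subset_left.eventuallyLE
        exact (ae_restrict_iff' hA.measurableSet).2
          (ae_of_all _ fun y hy => G_nonneg hzH (hA.subset hy))

/-- Lower bound for the travelling speed. -/
lemma IsPatch.speed_ge {A : Set (ℝ × ℝ)} (hA : IsPatch A) (hmax : IsMaximalPatch A) {W γ : ℝ}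
    (hW : 0 < W) (hAeq : A = {x ∈ H | 0 < pot A x - W * x.2 - γ})
    (hv : volume.real A = 1) {s : ℝ} (hs : 0 < s) (hs1 : s ≤ 1 / 10 ^ 17)
    (hM : ∫ x in A, x.2 = 8 * s ^ 3) : s / 10 ^ 21 ≤ W := by
  have hpi := Real.pi_gt_three
  have hγ : γ ≤ 24 * s ^ 3 := by
    calc γ = ∫ _ in A, γ := by simp [hv]
      _ ≤ ∫ x in A, 3 * x.2 := by
          refine setIntegral_mono_on (integrableOn_const hA.volume_ne_top)
            (hA.integrableOn_snd.const_mul _) hA.measurableSet fun x hx => ?_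
          have hxH := hA.subset hx
          have hx' : 0 < x.2 := hxH
          have h1 := hA.pot_le hxH
          rw [hAeq] at hx
          have h2 := hx.2
          have h3 : x.2 / π * (8 + volume.real A) ≤ x.2 / 3 * (8 + 1) := by rw [hv]; gcongr
          have h4 : 0 < W * x.2 := by positivity
          linarith
      _ = 24 * s ^ 3 := by rw [integral_const_mul, hM]; ring
  obtain ⟨x, hxA, hx⟩ := hA.exists_pot_gt hmax hs (by linarith) hM
  obtain ⟨z, hzH, hzA, hz, hpot⟩ := hA.exists_notMem_pot_ge hs hM (hA.subset hxA) hx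
  have h1 : pot A z - W * z.2 - γ ≤ 0 := by
    by_contra! h
    exact hzA (hAeq ▸ ⟨hzH, h⟩)
  have h2 : W * z.2 ≤ W * (8 * (40000 * s)) := by gcongr
  have h3 : s ^ 3 ≤ s ^ 2 * (1 / 10 ^ 17) := by
    rw [pow_succ]; gcongr
  have h4 : s * (s / 10 ^ 21) ≤ s * W := by nlinarith [sq_nonneg s]
  exact le_of_mul_le_mul_left h4 hs

lemma IsPatch.integrableOn_snd_mul_inv_dist {A : Set (ℝ × ℝ)} (hA : IsPatch A) (x : ℝ × ℝ) :
    IntegrableOn (fun y : ℝ × ℝ => y.2 * (dist x y)⁻¹) A := by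
  have hi := integrableOn_inv_dist hA.measurableSet hA.volume_ne_top x
  refine Integrable.mono' ((hi.const_mul |x.2|).add (integrableOn_const (C := (1 : ℝ))
    hA.volume_ne_top)) (by fun_prop) (ae_of_all _ fun y => ?_)
  have h1 := (abs_sub_abs_le_abs_sub y.2 x.2).trans
    ((abs_snd_sub_le_dist y x).trans_eq (dist_comm y x))
  simp only [Pi.add_apply, norm_mul, Real.norm_eq_abs, norm_inv,
    abs_of_nonneg (dist_nonneg (x := x) (y := y))]
  rcases eq_or_lt_of_le (dist_nonneg (x := x) (y := y)) with h | h
  · simp [← h]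
  · calc |y.2| * (dist x y)⁻¹ ≤ (|x.2| + dist x y) * (dist x y)⁻¹ := by gcongr; linarith
      _ = _ := by field_simp

/-- Upper bound for the travelling speed. -/
lemma IsPatch.speed_le {A : Set (ℝ × ℝ)} (hA : IsPatch A) {W γ : ℝ} (hγ : 0 ≤ γ)
    (hAeq : A = {x ∈ H | 0 < pot A x - W * x.2 - γ}) (hv : volume.real A = 1) {t : ℝ}
    (ht : 0 < t) : W ≤ 3 * t + 3 * (∫ x in A, x.2) / t := by
  have hpi := Real.pi_gt_three
  have hK := hA.integrable_kernel hA.measurableSet hA.volume_ne_top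
  have hvint : IntegrableOn (fun x => ∫ y in A, y.2 * (dist y x)⁻¹) A := hK.swap.integral_prod_left
  have hvle : ∫ x in A, ∫ y in A, y.2 * (dist y x)⁻¹ ≤ 9 * ∫ x in A, x.2 := by
    rw [← integral_integral_swap (f := fun y x : ℝ × ℝ => y.2 * (dist y x)⁻¹) hK,
      ← integral_const_mul]
    refine setIntegral_mono_on hK.integral_prod_left (hA.integrableOn_snd.const_mul _)
      hA.measurableSet fun x hx => ?_
    have hx' : 0 < x.2 := hA.subset hx
    have := setIntegral_inv_dist_le hA.measurableSet hA.volume_ne_top x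
    rw [integral_const_mul]
    rw [hv] at this
    nlinarith
  have hpt : ∀ x ∈ A, W ≤ 3 * t + 1 / (3 * t) * ∫ y in A, y.2 * (dist y x)⁻¹ := by
    intro x hx
    have hxH := hA.subset hx
    have hx' : 0 < x.2 := hxH
    have hb : MeasurableSet (Metric.ball x t) := Metric.isOpen_ball.measurableSet
    have hI := hA.integrableOn_snd_mul_inv_dist x
    have hv0 : ∀ y ∈ A, 0 ≤ y.2 * (dist x y)⁻¹ := fun y hy =>
      mul_nonneg (hA.subset hy).le (by positivity)
    have hnear : ∫ y in A ∩ Metric.ball x t, G x y ≤ x.2 / π * (8 * t) := by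
      calc _ ≤ ∫ y in A ∩ Metric.ball x t, x.2 / π * (dist x y)⁻¹ :=
            setIntegral_mono_on ((hA.integrableOn_G hxH).mono_set inter_subset_left)
              (((integrableOn_inv_dist_ball x _).mono_set inter_subset_right).const_mul _)
              (hA.measurableSet.inter hb) fun y hy => G_le_inv_dist hxH (hA.subset hy.1)
        _ = x.2 / π * ∫ y in A ∩ Metric.ball x t, (dist x y)⁻¹ := integral_const_mul _ _
        _ ≤ _ := by
            have := setIntegral_inv_dist_inter_ball_le A x ht.le
            gcongr
    have hfar : ∫ y in A \ Metric.ball x t, G x y ≤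
        x.2 / π * (1 / t * ∫ y in A, y.2 * (dist x y)⁻¹) := by
      calc _ ≤ ∫ y in A \ Metric.ball x t, x.2 / π * (1 / t * (y.2 * (dist x y)⁻¹)) := by
            refine setIntegral_mono_on ((hA.integrableOn_G hxH).mono_set sdiff_subset)
              (((hI.mono_set sdiff_subset).const_mul _).const_mul _) (hA.measurableSet.diff hb) ?_
            rintro y ⟨hyA, hyb⟩
            rw [Metric.mem_ball, not_lt, dist_comm] at hyb
            have hy' : 0 < y.2 := hA.subset hyA
            refine (G_le_inv_dist_sq hxH (hA.subset hyA)).trans ?_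
            have hd : 0 < dist x y := ht.trans_le hyb
            gcongr
            calc y.2 / dist x y ^ 2 = 1 / dist x y * (y.2 * (dist x y)⁻¹) := by field_simp
              _ ≤ _ := by gcongr
        _ = x.2 / π * (1 / t * ∫ y in A \ Metric.ball x t, y.2 * (dist x y)⁻¹) := by
            rw [integral_const_mul, integral_const_mul]
        _ ≤ _ := by
            have := setIntegral_mono_set hI ((ae_restrict_iff' hA.measurableSet).2
              (ae_of_all _ hv0)) (sdiff_subset : A \ Metric.ball x t ⊆ A).eventuallyLE
            gcongr
    have hsplit := integral_inter_add_sdiff hb (hA.integrableOn_G hxH)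
    have hpos : 0 < pot A x - W * x.2 - γ := ((Set.ext_iff.1 hAeq x).1 hx).2
    simp only [fun y => dist_comm y x]
    set v := ∫ y in A, y.2 * (dist x y)⁻¹
    have hvx : 0 ≤ v := setIntegral_nonneg hA.measurableSet hv0
    have h1 : x.2 * W ≤ x.2 * (1 / π * (8 * t + 1 / t * v)) := by
      have : x.2 * (1 / π * (8 * t + 1 / t * v)) =
        x.2 / π * (8 * t) + x.2 / π * (1 / t * v) := by ring
      rw [pot] at hpos
      linarith
    calc W ≤ 1 / π * (8 * t + 1 / t * v) := le_of_mul_le_mul_left h1 hx'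
      _ ≤ 1 / 3 * (9 * t + 1 / t * v) := by gcongr; norm_num
      _ = _ := by field_simp; norm_num
  have hc : Integrable (fun _ => 3 * t) (volume.restrict A) := integrableOn_const hA.volume_ne_top
  have h : ∫ _ in A, W ≤ ∫ x in A, (3 * t + 1 / (3 * t) * ∫ y in A, y.2 * (dist y x)⁻¹) :=
    setIntegral_mono_on (integrableOn_const hA.volume_ne_top)
      (hc.add (hvint.const_mul _)) hA.measurableSet hpt
  rw [integral_add hc (hvint.const_mul _), setIntegral_const, setIntegral_const, hv,
    one_smul, one_smul, integral_const_mul] at h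
  calc W ≤ _ := h
    _ ≤ 3 * t + 1 / (3 * t) * (9 * ∫ x in A, x.2) := by gcongr
    _ = _ := by field_simp; ring

/-- Maximizers of small impulse do not saturate the mass constraint. -/
lemma IsPatch.volume_ne_one {A : Set (ℝ × ℝ)} (hA : IsPatch A) (hmax : IsMaximalPatch A)
    {W γ : ℝ} (hW : 0 < W) (hγ : 0 ≤ γ) (hAeq : A = {x ∈ H | 0 < pot A x - W * x.2 - γ}) {s : ℝ}
    (hs : 0 < s) (hs1 : s ≤ 1 / 10 ^ 46) (hM : ∫ x in A, x.2 = 8 * s ^ 3) :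
    volume.real A ≠ 1 := by
  intro hv
  have h1 := hA.speed_ge hmax hW hAeq hv hs (by linarith) hM
  have h2 := hA.speed_le hγ hAeq hv (show 0 < s / 10 ^ 22 by positivity)
  have h3 : 3 * (8 * s ^ 3) / (s / 10 ^ 22) = 24 * 10 ^ 22 * s * s := by field_simp; norm_num
  rw [hM, h3] at h2
  have h4 : 24 * 10 ^ 22 * s * s ≤ 24 * 10 ^ 22 * s * (1 / 10 ^ 46) := by gcongr
  linarith

/-! ### From vorticities to patches -/

lemma setIntegral_mul_eq_of_ae_eq_indicator {A : Set (ℝ × ℝ)} (hA : MeasurableSet A) (hAH : A ⊆ H)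
    {ω : ℝ × ℝ → ℝ} (hω : ∀ᵐ x ∂volume.restrict H, ω x = A.indicator (fun _ => (1 : ℝ)) x)
    (f : ℝ × ℝ → ℝ) : ∫ x in H, f x * ω x = ∫ x in A, f x := by
  calc ∫ x in H, f x * ω x = ∫ x in H, A.indicator f x := by
        refine integral_congr_ae ?_
        filter_upwards [hω] with x hx
        by_cases h : x ∈ A <;> simp [hx, h]
    _ = ∫ x in A, f x := by rw [setIntegral_indicator hA, inter_eq_self_of_subset_right hAH]

lemma energy_eq_of_ae_eq_indicator {A : Set (ℝ × ℝ)} (hA : MeasurableSet A) (hAH : A ⊆ H)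
    {ω : ℝ × ℝ → ℝ} (hω : ∀ᵐ x ∂volume.restrict H, ω x = A.indicator (fun _ => (1 : ℝ)) x) :
    energy ω = 1 / 2 * ∫ x in A, pot A x := by
  unfold energy
  congr 1
  rw [← setIntegral_mul_eq_of_ae_eq_indicator hA hAH hω]
  refine integral_congr_ae (ae_of_all _ fun x => ?_)
  simp only
  rw [setIntegral_mul_eq_of_ae_eq_indicator hA hAH hω (fun y => G x y * ω x), integral_mul_const,
    pot]

lemma Gpot_eq_of_ae_eq_indicator {A : Set (ℝ × ℝ)} (hA : MeasurableSet A) (hAH : A ⊆ H)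
    {ω : ℝ × ℝ → ℝ} (hω : ∀ᵐ x ∂volume.restrict H, ω x = A.indicator (fun _ => (1 : ℝ)) x) :
    Gpot ω = pot A :=
  funext fun x => setIntegral_mul_eq_of_ae_eq_indicator hA hAH hω (G x)

lemma IsPatch.memK {A : Set (ℝ × ℝ)} (hA : IsPatch A) (hv : volume.real A ≤ 1) {M : ℝ}
    (hM : ∫ x in A, x.2 = M) : memK M (A.indicator fun _ => (1 : ℝ)) := by
  refine ⟨?_, A, hA.subset, hA.measurableSet, ae_of_all _ fun _ => rfl, hM, ?_⟩
  · exact (integrable_indicator_iff hA.measurableSet).2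
      ((integrableOn_const hA.volume_ne_top).mono_measure Measure.restrict_le_self)
  · rw [← ENNReal.ofReal_toReal hA.volume_ne_top]
    exact ENNReal.ofReal_le_one.2 hv

/-- A maximizer satisfying the vortex equation is the indicator of a maximal patch that is
exactly a superlevel set of its own adjusted stream function. -/
lemma exists_isMaximalPatch_of_memS {M : ℝ} (hM : 0 < M) {ω : ℝ × ℝ → ℝ} (hω : memS M ω) {W γ : ℝ}
    (h : ∀ᵐ x ∂volume.restrict H,
      ω x = Set.indicator {y ∈ H | 0 < Gpot ω y - W * y.2 - γ} (fun _ => (1 : ℝ)) x) :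
    ∃ A, IsPatch A ∧ IsMaximalPatch A ∧ A = {x ∈ H | 0 < pot A x - W * x.2 - γ} ∧
      (∫ x in A, x.2 = M) ∧ volume.real A ≤ 1 := by
  obtain ⟨⟨-, B, hBH, hB, hωB, hBM, hBv⟩, hmax⟩ := hω
  have hBpatch : IsPatch B := by
    refine ⟨hB, hBH, (hBv.trans_lt ENNReal.one_lt_top).ne, ?_⟩
    by_contra hint
    exact hM.ne (by rw [← hBM, integral_undef hint])
  have hpotB := Gpot_eq_of_ae_eq_indicator hB hBH hωB
  rw [hpotB] at h
  obtain ⟨-, hopen⟩ := hBpatch.isOpen_levelSet W γ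
  set A := {x ∈ H | 0 < pot B x - W * x.2 - γ} with hA
  have hAH : A ⊆ H := fun x hx => hx.1
  have hAB : A =ᵐ[volume] B := by
    have h1 := (ae_restrict_iff' isOpen_H.measurableSet).1 h
    have h2 := (ae_restrict_iff' isOpen_H.measurableSet).1 hωB
    filter_upwards [h1, h2] with x hx1 hx2
    refine propext ?_
    change x ∈ A ↔ x ∈ B
    by_cases hx : x ∈ H
    · have := (hx1 hx).symm.trans (hx2 hx)
      by_cases hxA : x ∈ A <;> by_cases hxB : x ∈ B <;> simp [hxA, hxB] at this ⊢
    · exact ⟨fun hxA => absurd (hAH hxA) hx, fun hxB => absurd (hBH hxB) hx⟩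
  have hpot : pot A = pot B := funext fun x => setIntegral_congr_set hAB
  have hAM : ∫ x in A, x.2 = M := (setIntegral_congr_set hAB).trans hBM
  have hAv : volume A ≤ 1 := (measure_congr hAB).trans_le hBv
  refine ⟨A, ⟨hopen.measurableSet, hAH, (hAv.trans_lt ENNReal.one_lt_top).ne,
    hBpatch.integrableOn_snd.congr_set_ae hAB⟩, ?_, by rw [hpot], hAM, ?_⟩
  · intro A' hA' hA'M hA'v
    have h1 := hmax _ (hA'.memK hA'v (hA'M.trans hAM))
    rw [energy_eq_of_ae_eq_indicator hA'.measurableSet hA'.subset (ae_of_all _ fun _ => rfl),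
      energy_eq_of_ae_eq_indicator hopen.measurableSet hAH h] at h1
    linarith
  · exact ENNReal.toReal_le_of_le_ofReal zero_le_one (by simpa using hAv)

/-- for sufficiently small impulse, the flux constant of every
maximizer vanishes. -/
theorem small_impulse_implies_zero_flux :
    ∃ M₁ : ℝ, 0 < M₁ ∧ ∀ M : ℝ, 0 < M → M < M₁ →
      ∀ ω : ℝ × ℝ → ℝ, memS M ω → ∀ W γ : ℝ, 0 < W → 0 ≤ γ →
        (∀ᵐ x ∂volume.restrict H,
          ω x = Set.indicator {y ∈ H | 0 < Gpot ω y - W * y.2 - γ} (fun _ => (1 : ℝ)) x) →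
        γ = 0 := by
  refine ⟨8 * (1 / 10 ^ 46) ^ 3, by positivity, fun M hM hM1 ω hω W γ hW hγ h => ?_⟩
  obtain ⟨A, hA, hmax, hAeq, hAM, hAv⟩ := exists_isMaximalPatch_of_memS hM hω h
  set s := (M / 8) ^ (1 / 3 : ℝ) with hs
  have hs0 : 0 < s := by positivity
  have hs3 : s ^ 3 = M / 8 := by
    rw [hs, ← Real.rpow_natCast, ← Real.rpow_mul (by positivity)]
    norm_num
  have hs1 : s ≤ 1 / 10 ^ 46 := by
    refine le_of_pow_le_pow_left₀ three_ne_zero (by positivity) ?_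
    linarith
  have hne : A.Nonempty := by
    by_contra! hA0
    simp [hA0] at hAM
    exact hM.ne hAM
  have hv := hA.volume_ne_one hmax hW hγ hAeq hs0 hs1 (by rw [hAM, hs3]; ring)
  exact hA.flux_eq_zero_of_volume_lt_one hW hγ hAeq hne (lt_of_le_of_ne hAv hv) hmax
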